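/- Let μ be a probability distribution on ℝ^d admitting a Lebesgue density ρ, let P_r be a rank-r projector, and let U_⊥ ∈ ℝ^{d×(d−r)} be a matrix whose columns form a basis of Ker(P_r). Define the conditional density p_⊥(ξ_⊥ | P_r x) = ρ(P_r x + U_⊥ ξ_⊥) / ∫_{ℝ^{d−r}} ρ(P_r x + U_⊥ ξ_⊥′) dξ_⊥′ (set to 0 when the denominator vanishes). Then for any measurable f : ℝ^d → ℝ₊ with ∫ f dμ < ∞, the conditional expectation E_μ(f | σ(P_r)) is given μ-almost everywhere by the map x ↦ ∫_{ℝ^{d−r}} f(P_r x + U_⊥ ξ_⊥) p_⊥(ξ_⊥ | P_r x) dξ_⊥. -/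

import Mathlib

open MeasureTheory Matrix

open scoped ENNReal

section FiberIntegral

variable {E K : Type*} [AddCommGroup E] [AddCommGroup K] [MeasurableSpace K]

/-- The integral of `b` over the translate through `x` of the image of `L`, parametrized by `L`. -/
noncomputable def fiberLIntegral (κ : Measure K) (L : K →+ E) (b : E → ℝ≥0∞) (x : E) : ℝ≥0∞ :=
  ∫⁻ ξ, b (x + L ξ) ∂κ

variable {κ : Measure K} {L : K →+ E}

lemma fiberLIntegral_add_apply [MeasurableAdd K] [κ.IsAddLeftInvariant]
    (b : E → ℝ≥0∞) (x : E) (η : K) :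
    fiberLIntegral κ L b (x + L η) = fiberLIntegral κ L b x := by
  unfold fiberLIntegral
  rw [← lintegral_add_left_eq_self (fun ξ => b (x + L ξ)) η]
  simp only [map_add, add_assoc]

variable [MeasurableSpace E]

lemma measurable_fiberLIntegral [SFinite κ] [MeasurableAdd₂ E] (hL : Measurable L)
    {b : E → ℝ≥0∞} (hb : Measurable b) : Measurable (fiberLIntegral κ L b) :=
  Measurable.lintegral_prod_right'
    (hb.comp (measurable_fst.add (hL.comp measurable_snd)))

lemma fiberLIntegral_invariant_mul [MeasurableAdd₂ E] (hL : Measurable L)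
    {a b : E → ℝ≥0∞} (ha : ∀ x η, a (x + L η) = a x) (hb : Measurable b) (x : E) :
    fiberLIntegral κ L (fun y => a y * b y) x = a x * fiberLIntegral κ L b x := by
  unfold fiberLIntegral
  simp only [ha]
  exact lintegral_const_mul _ (hb.comp (measurable_const.add hL))

lemma lintegral_mul_fiberLIntegral_comm {ν : Measure E} [SFinite ν] [SFinite κ]
    [MeasurableAdd₂ E] [MeasurableNeg E] [MeasurableNeg K] [ν.IsAddLeftInvariant]
    [κ.IsNegInvariant] (hL : Measurable L) {a b : E → ℝ≥0∞}
    (ha : Measurable a) (hb : Measurable b) :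
    ∫⁻ x, a x * fiberLIntegral κ L b x ∂ν = ∫⁻ x, fiberLIntegral κ L a x * b x ∂ν := by
  have hadd : Measurable fun p : E × K => p.1 + L p.2 :=
    measurable_fst.add (hL.comp measurable_snd)
  have hsub : Measurable fun p : E × K => p.1 + L (-p.2) :=
    measurable_fst.add (hL.comp measurable_snd.neg)
  calc ∫⁻ x, a x * fiberLIntegral κ L b x ∂ν
      = ∫⁻ x, ∫⁻ ξ, a x * b (x + L ξ) ∂κ ∂ν := by
        refine lintegral_congr fun x => ?_
        exact (lintegral_const_mul _ (hb.comp (measurable_const.add hL))).symm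
    _ = ∫⁻ ξ, ∫⁻ x, a x * b (x + L ξ) ∂ν ∂κ :=
        lintegral_lintegral_swap
          ((ha.comp measurable_fst).mul (hb.comp hadd)).aemeasurable
    _ = ∫⁻ ξ, ∫⁻ x, a (x + L (-ξ)) * b x ∂ν ∂κ := by
        refine lintegral_congr fun ξ => ?_
        rw [← lintegral_add_right_eq_self (fun x => a (x + L (-ξ)) * b x) (L ξ)]
        simp
    _ = ∫⁻ x, ∫⁻ ξ, a (x + L (-ξ)) * b x ∂κ ∂ν :=
        lintegral_lintegral_swap (f := fun ξ x => a (x + L (-ξ)) * b x)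
          (((ha.comp hsub).comp measurable_swap).mul
            (hb.comp measurable_snd)).aemeasurable
    _ = ∫⁻ x, fiberLIntegral κ L a x * b x ∂ν := by
        refine lintegral_congr fun x => ?_
        have hm : Measurable fun ξ => a (x + L (-ξ)) :=
          ha.comp (measurable_const.add (hL.comp measurable_neg))
        rw [lintegral_mul_const _ hm]
        congr 1
        exact lintegral_neg_eq_self (fun ξ => a (x + L ξ)) (μ := κ)

/-- Almost every point where `b` does not vanish lies on a fiber of nonzero integral. -/
lemma ae_eq_zero_of_fiberLIntegral_eq_zero {ν : Measure E} [SFinite ν] [SFinite κ] [NeZero κ]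
    [MeasurableAdd₂ E] [MeasurableNeg E] [MeasurableNeg K] [MeasurableAdd K]
    [ν.IsAddLeftInvariant] [κ.IsAddLeftInvariant] [κ.IsNegInvariant] (hL : Measurable L)
    {b : E → ℝ≥0∞} (hb : Measurable b) :
    ∀ᵐ x ∂ν, fiberLIntegral κ L b x = 0 → b x = 0 := by
  have hS := measurable_fiberLIntegral (κ := κ) hL hb
  have hN : MeasurableSet {x | fiberLIntegral κ L b x = 0} := hS (measurableSet_singleton 0)
  set a : E → ℝ≥0∞ := {x | fiberLIntegral κ L b x = 0}.indicator 1 with ha_def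
  have ha : Measurable a := measurable_one.indicator hN
  have hinv : ∀ x η, a (x + L η) = a x := fun x η => by
    simp [ha_def, Set.indicator, fiberLIntegral_add_apply]
  have h := lintegral_mul_fiberLIntegral_comm (ν := ν) (κ := κ) hL ha hb
  have h0 : ∫⁻ x, a x * fiberLIntegral κ L b x ∂ν = 0 := by
    rw [← lintegral_zero (μ := ν)]
    refine lintegral_congr fun x => ?_
    by_cases hx : fiberLIntegral κ L b x = 0 <;> simp [ha_def, hx]
  have hm : Measurable fun x => fiberLIntegral κ L a x * b x :=
    (measurable_fiberLIntegral hL ha).mul hb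
  rw [h0, eq_comm, lintegral_eq_zero_iff hm] at h
  filter_upwards [h] with x hx hx0
  have hSa : fiberLIntegral κ L a x = κ Set.univ := by
    have hax : a x = 1 := by simp [ha_def, hx0]
    rw [fiberLIntegral]
    simp only [hinv, hax, lintegral_one]
  simpa [hSa, NeZero.ne κ] using hx

/-- If `L` has a measurable additive left inverse, the fiber integrals of an integrable function
are almost everywhere finite. -/
lemma ae_fiberLIntegral_ne_top {ν : Measure E} [SFinite ν] [SigmaFinite κ]
    [MeasurableAdd₂ E] [MeasurableNeg E] [MeasurableNeg K] [MeasurableAdd K]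
    [ν.IsAddLeftInvariant] [κ.IsAddLeftInvariant] [κ.IsNegInvariant] (hL : Measurable L)
    {R : E →+ K} (hR : Measurable R) (hRL : ∀ ξ, R (L ξ) = ξ)
    {b : E → ℝ≥0∞} (hb : Measurable b) (hfin : ∫⁻ x, b x ∂ν ≠ ∞) :
    ∀ᵐ x ∂ν, fiberLIntegral κ L b x ≠ ∞ := by
  obtain ⟨g, hg0, hg, hg1⟩ := exists_pos_lintegral_lt_of_sigmaFinite κ one_ne_zero
  set k : E → ℝ≥0∞ := fun x => g (R x) with hk_def
  have hk : Measurable k := (hg.comp hR).coe_nnreal_ennreal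
  have hSk : ∀ x, fiberLIntegral κ L k x = ∫⁻ ξ, g ξ ∂κ := fun x => by
    simp only [fiberLIntegral, hk_def, map_add, hRL]
    exact lintegral_add_left_eq_self (fun ξ => (g ξ : ℝ≥0∞)) (R x)
  have hS := measurable_fiberLIntegral (κ := κ) hL hb
  have h := lintegral_mul_fiberLIntegral_comm (ν := ν) (κ := κ) hL hk hb
  have hne : ∫⁻ x, k x * fiberLIntegral κ L b x ∂ν ≠ ∞ := by
    rw [h]
    simp only [hSk]
    rw [lintegral_const_mul _ hb]
    exact ENNReal.mul_ne_top (hg1.trans ENNReal.one_lt_top).ne hfin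
  filter_upwards [ae_lt_top (hk.mul hS) hne] with x hx htop
  have hkx : k x ≠ 0 := by simpa [hk_def] using (hg0 (R x)).ne'
  simp [htop, ENNReal.mul_top hkx] at hx

/-- Averaging over fibers against the normalized density preserves integrals over sets which are
unions of fibers. -/
lemma setLIntegral_fiberLIntegral_div {ν : Measure E} [SFinite ν] [SigmaFinite κ] [NeZero κ]
    [MeasurableAdd₂ E] [MeasurableNeg E] [MeasurableNeg K] [MeasurableAdd K]
    [ν.IsAddLeftInvariant] [κ.IsAddLeftInvariant] [κ.IsNegInvariant] (hL : Measurable L)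
    {R : E →+ K} (hR : Measurable R) (hRL : ∀ ξ, R (L ξ) = ξ)
    {b : E → ℝ≥0∞} (hb : Measurable b) (hfin : ∫⁻ x, b x ∂ν ≠ ∞)
    {F : E → ℝ≥0∞} (hF : Measurable F) {A : Set E} (hA : MeasurableSet A)
    (hAinv : ∀ x η, x + L η ∈ A ↔ x ∈ A) :
    ∫⁻ x in A, fiberLIntegral κ L (fun y => F y * b y) x / fiberLIntegral κ L b x
        ∂(ν.withDensity b) = ∫⁻ x in A, F x ∂(ν.withDensity b) := by
  have hSb := measurable_fiberLIntegral (κ := κ) hL hb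
  have hG : Measurable fun x =>
      fiberLIntegral κ L (fun y => F y * b y) x / fiberLIntegral κ L b x :=
    (measurable_fiberLIntegral hL (hF.mul hb)).div hSb
  set c : E → ℝ≥0∞ := fun x => A.indicator 1 x * (fiberLIntegral κ L b x)⁻¹ with hc_def
  have hc : Measurable c := (measurable_one.indicator hA).mul hSb.inv
  have hcinv : ∀ x η, c (x + L η) = c x := fun x η => by
    by_cases hx : x ∈ A <;> simp [hc_def, fiberLIntegral_add_apply, hAinv, hx]
  rw [← lintegral_indicator hA, ← lintegral_indicator hA,
    lintegral_withDensity_eq_lintegral_mul _ hb (hG.indicator hA),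
    lintegral_withDensity_eq_lintegral_mul _ hb (hF.indicator hA)]
  calc _ = ∫⁻ x, (c x * b x) * fiberLIntegral κ L (fun y => F y * b y) x ∂ν := by
        refine lintegral_congr fun x => ?_
        by_cases hx : x ∈ A <;> simp [hc_def, hx, div_eq_mul_inv]
        ring
    _ = ∫⁻ x, fiberLIntegral κ L (fun y => c y * b y) x * (F x * b x) ∂ν :=
        lintegral_mul_fiberLIntegral_comm hL (hc.mul hb) (hF.mul hb)
    _ = _ := by
        refine lintegral_congr_ae ?_
        filter_upwards [ae_eq_zero_of_fiberLIntegral_eq_zero (ν := ν) (κ := κ) hL hb,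
          ae_fiberLIntegral_ne_top (ν := ν) (κ := κ) hL hR hRL hb hfin] with x h0 htop
        rw [fiberLIntegral_invariant_mul hL hcinv hb]
        by_cases hbx : b x = 0
        · simp [hbx]
        by_cases hx : x ∈ A
        · simp [hc_def, hx, ENNReal.inv_mul_cancel (fun h => hbx (h0 h)) htop, mul_comm]
        · simp [hc_def, hx]

end FiberIntegral

/-- **Explicit expression for the conditional expectation.**
If `μ` has Lebesgue density `ρ`, `P_r` is a rank-`r` projector and the columns of
`U_⊥ ∈ ℝ^{d×(d−r)}` form a basis of `Ker(P_r)`, then for any measurable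
`f : ℝ^d → ℝ₊` with `∫ f dμ < ∞`, `μ`-a.e.
`E_μ(f | σ(P_r))(x) = ∫ f(P_r x + U_⊥ ξ_⊥) p_⊥(ξ_⊥ | P_r x) dξ_⊥`, where
`p_⊥(ξ_⊥ | P_r x) = ρ(P_r x + U_⊥ ξ_⊥) / ∫ ρ(P_r x + U_⊥ ξ_⊥') dξ_⊥'`
(interpreted as `0` when the denominator vanishes, which is Lean's convention for
division by zero). -/
theorem condexp_explicit (d r : ℕ) (hr : r ≤ d)
    (ρ : (Fin d → ℝ) → ℝ) (hρmeas : Measurable ρ) (hρ0 : ∀ x, 0 ≤ ρ x)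
    (μ : Measure (Fin d → ℝ)) [IsProbabilityMeasure μ]
    (hμ : μ = volume.withDensity fun x => ENNReal.ofReal (ρ x))
    (P : Matrix (Fin d) (Fin d) ℝ) (hP : P * P = P) (hrank : P.rank = r)
    (Uperp : Matrix (Fin d) (Fin (d - r)) ℝ)
    (hUli : LinearIndependent ℝ (fun j => Uperpᵀ j))
    (hUspan : Submodule.span ℝ (Set.range fun j => Uperpᵀ j) = LinearMap.ker P.mulVecLin)
    (f : (Fin d → ℝ) → ℝ) (hf : Measurable f) (hf0 : ∀ x, 0 ≤ f x)
    (hfInt : Integrable f μ) :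
    μ[f| MeasurableSpace.comap (fun x => P.mulVec x)
          (inferInstance : MeasurableSpace (Fin d → ℝ))]
      =ᵐ[μ] fun x =>
        ∫ ξ : Fin (d - r) → ℝ,
          f (P.mulVec x + Uperp.mulVec ξ) *
            (ρ (P.mulVec x + Uperp.mulVec ξ) /
              ∫ ξ' : Fin (d - r) → ℝ, ρ (P.mulVec x + Uperp.mulVec ξ')) := by
  have hrange : LinearMap.range Uperp.mulVecLin = LinearMap.ker P.mulVecLin := by
    rw [← hUspan, Matrix.range_mulVecLin]; rfl
  have hPU : ∀ ξ, P.mulVec (Uperp.mulVec ξ) = 0 := fun ξ => by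
    have : Uperp.mulVecLin ξ ∈ LinearMap.ker P.mulVecLin := hrange ▸ LinearMap.mem_range_self _ ξ
    simpa using this
  have hmem : ∀ x, ∃ η, P.mulVec x + Uperp.mulVec η = x := fun x => by
    have : x - P.mulVec x ∈ LinearMap.range Uperp.mulVecLin := by
      rw [hrange]; simp [Matrix.mulVec_sub, hP]
    obtain ⟨η, hη⟩ := this
    refine ⟨η, ?_⟩
    rw [Matrix.mulVecLin_apply] at hη
    rw [hη]; abel
  obtain ⟨R, hR⟩ := Uperp.mulVecLin.exists_leftInverse_of_injective
    (LinearMap.ker_eq_bot.2 (Matrix.mulVec_injective_iff.2 hUli))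
  have hRL : ∀ ξ, R.toAddMonoidHom (Uperp.mulVecLin.toAddMonoidHom ξ) = ξ :=
    fun ξ => LinearMap.congr_fun hR ξ
  have hRm : Measurable R.toAddMonoidHom := R.continuous_of_finiteDimensional.measurable
  set L : (Fin (d - r) → ℝ) →+ (Fin d → ℝ) := Uperp.mulVecLin.toAddMonoidHom with hL_def
  have hLapp : ∀ ξ, L ξ = Uperp.mulVec ξ := fun ξ => rfl
  have hL : Measurable L := Uperp.mulVecLin.continuous_of_finiteDimensional.measurable
  have hPm : Measurable fun x => P.mulVec x :=
    P.mulVecLin.continuous_of_finiteDimensional.measurable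
  set b : (Fin d → ℝ) → ℝ≥0∞ := fun x => ENNReal.ofReal (ρ x) with hb_def
  have hb : Measurable b := hρmeas.ennreal_ofReal
  set F : (Fin d → ℝ) → ℝ≥0∞ := fun x => ENNReal.ofReal (f x) with hF_def
  have hF : Measurable F := hf.ennreal_ofReal
  set G : (Fin d → ℝ) → ℝ≥0∞ := fun x =>
    fiberLIntegral volume L (fun y => F y * b y) x / fiberLIntegral volume L b x with hG_def
  have hG : Measurable G :=
    (measurable_fiberLIntegral hL (hF.mul hb)).div (measurable_fiberLIntegral hL hb)
  have hGP : ∀ x, G (P.mulVec x) = G x := fun x => by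
    obtain ⟨η, hη⟩ := hmem x
    conv_rhs => rw [← hη, ← hLapp]
    simp only [hG_def, fiberLIntegral_add_apply]
  have hfin : ∫⁻ x, b x ≠ ∞ := by
    have h1 : μ Set.univ = 1 := measure_univ
    rw [hμ, withDensity_apply _ MeasurableSet.univ, setLIntegral_univ] at h1
    simp [h1]
  have hset : ∀ A : Set (Fin d → ℝ),
      MeasurableSet[MeasurableSpace.comap (fun x => P.mulVec x) inferInstance] A →
        ∫⁻ x in A, G x ∂μ = ∫⁻ x in A, F x ∂μ := by
    rintro _ ⟨B, hB, rfl⟩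
    rw [hμ]
    refine setLIntegral_fiberLIntegral_div hL hRm hRL hb hfin hF (hPm hB) fun x η => ?_
    simp [hLapp, Matrix.mulVec_add, hPU]
  have hFfin : ∫⁻ x, F x ∂μ ≠ ∞ := hfInt.lintegral_lt_top.ne
  have hGint : ∫⁻ x, G x ∂μ ≠ ∞ := by
    have := hset Set.univ MeasurableSet.univ
    simp only [setLIntegral_univ] at this
    rwa [this]
  have hform : (fun x => ∫ ξ : Fin (d - r) → ℝ,
          f (P.mulVec x + Uperp.mulVec ξ) *
            (ρ (P.mulVec x + Uperp.mulVec ξ) /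
              ∫ ξ' : Fin (d - r) → ℝ, ρ (P.mulVec x + Uperp.mulVec ξ'))) =
      fun x => (G (P.mulVec x)).toReal := by
    funext x
    have hm : Measurable fun ξ => P.mulVec x + Uperp.mulVec ξ := measurable_const.add hL
    simp only [← mul_div_assoc]
    rw [integral_div, hG_def, ENNReal.toReal_div,
      integral_eq_lintegral_of_nonneg_ae (ae_of_all _ fun _ => mul_nonneg (hf0 _) (hρ0 _))
        ((hf.comp hm).mul (hρmeas.comp hm)).aestronglyMeasurable,
      integral_eq_lintegral_of_nonneg_ae (ae_of_all _ fun _ => hρ0 _)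
        (hρmeas.comp hm).aestronglyMeasurable]
    simp only [fiberLIntegral, hF_def, hb_def, hLapp, ENNReal.ofReal_mul (hf0 _)]
  rw [hform]
  have hGi : Integrable (fun x => (G (P.mulVec x)).toReal) μ := by
    simp only [hGP]
    exact integrable_toReal_of_lintegral_ne_top hG.aemeasurable hGint
  refine (ae_eq_condExp_of_forall_setIntegral_eq hPm.comap_le hfInt
    (fun _ _ _ => hGi.integrableOn) (fun A hA _ => ?_) ?_).symm
  · simp only [hGP]
    rw [integral_toReal hG.aemeasurable.restrict
        (ae_restrict_of_ae (ae_lt_top hG hGint)), hset A hA,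
      integral_eq_lintegral_of_nonneg_ae (ae_of_all _ hf0) hf.aestronglyMeasurable]
  · exact (hG.ennreal_toReal.comp (comap_measurable _)).stronglyMeasurable.aestronglyMeasurable
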